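/- Assume a_{jk}(t) ≥ 0 for all j,k and almost all t ≥ 0 and that the time-varying graph G[A(·)] is cut-balanced. Then the protocol ẋ(t) = −L[A(t)]x(t) establishes consensus (for every solution there exists c with lim_{t→∞} x_i(t) = c for all i, and c ≠ 0 for some solution) if and only if the graph of essential interactions is strongly connected (equivalently, essentially connected). -/

import Mathlib

open MeasureTheory Filter Matrix Finset Topology

/-- The signed Laplacian `L[A]` of a signed adjacency matrix:
off-diagonal entries `L j k = -A j k`, diagonal entries `L j j = ∑ m, |A j m|`. -/
noncomputable def sLap {N : ℕ} (A : Matrix (Fin N) (Fin N) ℝ) : Matrix (Fin N) (Fin N) ℝ :=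
  fun j k => if j = k then ∑ m, |A j m| else -A j k

/-- A time-varying signed adjacency matrix: entrywise measurable, locally bounded,
with zero diagonal. -/
def IsAdjacency {N : ℕ} (A : ℝ → Matrix (Fin N) (Fin N) ℝ) : Prop :=
  (∀ j k, Measurable fun t => A t j k) ∧
  (∀ T : ℝ, ∃ C : ℝ, ∀ t ∈ Set.Icc (0:ℝ) T, ∀ j k, |A t j k| ≤ C) ∧
  (∀ t j, A t j j = 0)

/-- A solution of `ẋ = −L[A(t)]x` on `[0,∞)`: continuous and satisfying the integral
equation (equivalently, locally absolutely continuous and satisfying the ODE a.e.). -/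
def IsSolution {N : ℕ} (A : ℝ → Matrix (Fin N) (Fin N) ℝ) (x : ℝ → Fin N → ℝ) : Prop :=
  ContinuousOn x (Set.Ici 0) ∧
  ∀ t ∈ Set.Ici (0:ℝ), ∀ j,
    x t j = x 0 j + ∫ s in (0:ℝ)..t, -((sLap (A s)).mulVec (x s) j)

/-- Quasi-strong connectivity of the static signed graph `G[A]`: some root reaches
every node along arcs `k → j` present whenever `A j k ≠ 0`. -/
def QSC {N : ℕ} (A : Matrix (Fin N) (Fin N) ℝ) : Prop :=
  ∃ r : Fin N, ∀ j : Fin N, Relation.ReflTransGen (fun k j => A j k ≠ 0) r j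

/-- Structural balance of the static signed graph `G[A]`: the nodes split into the camp `S`
and its complement (one possibly empty), with nonnegative weights inside a camp and
nonpositive weights between camps. -/
def StructBal {N : ℕ} (A : Matrix (Fin N) (Fin N) ℝ) : Prop :=
  ∃ S : Set (Fin N), ∀ j k : Fin N,
    ((j ∈ S ↔ k ∈ S) → 0 ≤ A j k) ∧ (¬(j ∈ S ↔ k ∈ S) → A j k ≤ 0)

/-- `∫_0^∞ |a_{jk}(t)| dt = ∞`: arc `k → j` of the graph of essential interactions. -/
def EssArc {N : ℕ} (A : ℝ → Matrix (Fin N) (Fin N) ℝ) (j k : Fin N) : Prop :=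
  ∫⁻ t in Set.Ici (0:ℝ), ENNReal.ofReal |A t j k| = ⊤

/-- `∫_0^∞ a_{jk}⁺(t) dt = ∞`: agents `j` and `k` essentially cooperate. -/
def EssPlus {N : ℕ} (A : ℝ → Matrix (Fin N) (Fin N) ℝ) (j k : Fin N) : Prop :=
  ∫⁻ t in Set.Ici (0:ℝ), ENNReal.ofReal (max (A t j k) 0) = ⊤

/-- `∫_0^∞ a_{jk}⁻(t) dt = ∞`: agents `j` and `k` essentially compete. -/
def EssMinus {N : ℕ} (A : ℝ → Matrix (Fin N) (Fin N) ℝ) (j k : Fin N) : Prop :=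
  ∫⁻ t in Set.Ici (0:ℝ), ENNReal.ofReal (max (-(A t j k)) 0) = ⊤

/-- Reachability from `u` to `v` in the graph of essential interactions. -/
def EssReach {N : ℕ} (A : ℝ → Matrix (Fin N) (Fin N) ℝ) (u v : Fin N) : Prop :=
  Relation.ReflTransGen (fun k j => EssArc A j k) u v

/-- Uniform strong connectivity of the time-varying graph `G[A(·)]`. -/
def USC {N : ℕ} (A : ℝ → Matrix (Fin N) (Fin N) ℝ) : Prop :=
  ∃ T > (0:ℝ), ∃ ε > (0:ℝ), ∀ t ≥ (0:ℝ), ∀ u v : Fin N,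
    Relation.ReflTransGen (fun k j => ε ≤ ∫ s in t..(t + T), |A s j k|) u v

/-- Uniform quasi-strong connectivity of the time-varying graph `G[A(·)]`. -/
def UQSC {N : ℕ} (A : ℝ → Matrix (Fin N) (Fin N) ℝ) : Prop :=
  ∃ T > (0:ℝ), ∃ ε > (0:ℝ), ∀ t ≥ (0:ℝ), ∃ r : Fin N, ∀ j : Fin N,
    Relation.ReflTransGen (fun k j => ε ≤ ∫ s in t..(t + T), |A s j k|) r j

/-- Cut-balance of the time-varying graph `G[A(·)]` with some constant `K ≥ 1`. -/
def CutBalanced {N : ℕ} (A : ℝ → Matrix (Fin N) (Fin N) ℝ) : Prop :=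
  ∃ K : ℝ, 1 ≤ K ∧ ∀ᵐ t ∂(volume.restrict (Set.Ici (0:ℝ))),
    ∀ V : Finset (Fin N), V.Nonempty → V ≠ Finset.univ →
      K⁻¹ * (∑ j ∈ V, ∑ k ∈ Vᶜ, |A t k j|) ≤ (∑ j ∈ V, ∑ k ∈ Vᶜ, |A t j k|) ∧
      (∑ j ∈ V, ∑ k ∈ Vᶜ, |A t j k|) ≤ K * (∑ j ∈ V, ∑ k ∈ Vᶜ, |A t k j|)

/-- The protocol establishes modulus consensus: the moduli of all opinions converge
to a common limit for every solution. -/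
def ModulusConsensus {N : ℕ} (A : ℝ → Matrix (Fin N) (Fin N) ℝ) : Prop :=
  ∀ x : ℝ → Fin N → ℝ, IsSolution A x →
    ∃ c : ℝ, 0 ≤ c ∧ ∀ i, Tendsto (fun t => |x t i|) atTop (𝓝 c)

/-- The protocol establishes bipartite consensus: there are `v ≠ 0` and `ρ ∈ {±1}^N` such that
every solution converges to `ρ (vᵀ x(0))`. -/
def BipartiteConsensus {N : ℕ} (A : ℝ → Matrix (Fin N) (Fin N) ℝ) : Prop :=
  ∃ v ρ : Fin N → ℝ, v ≠ 0 ∧ (∀ i, ρ i = 1 ∨ ρ i = -1) ∧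
    ∀ x : ℝ → Fin N → ℝ, IsSolution A x →
      ∀ i, Tendsto (fun t => x t i) atTop (𝓝 (ρ i * ∑ j, v j * x 0 j))

/-- The essential-interaction signed graph `𝒢^±` is structurally balanced: the camp `S` and
its complement contain all essentially-cooperating pairs inside a camp and all
essentially-competing pairs between the camps. -/
def EssStructBal {N : ℕ} (A : ℝ → Matrix (Fin N) (Fin N) ℝ) : Prop :=
  ∃ S : Set (Fin N),
    (∀ j k, EssPlus A j k → (j ∈ S ↔ k ∈ S)) ∧
    (∀ j k, EssMinus A j k → ¬(j ∈ S ↔ k ∈ S))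

/-- If `F` is the pointwise minimum of a family of Lipschitz functions and, at almost every time,
some active member of the family has derivative at least `h`, then `F` grows at least as fast
as the integral of `h`. -/
theorem integral_le_sub_of_active_deriv_ge {ι : Type*} {f : ι → ℝ → ℝ} {F h : ℝ → ℝ} {a b : ℝ}
    (hab : a ≤ b) {K : NNReal} (hf : ∀ i, LipschitzOnWith K (f i) (Set.Icc a b))
    (hle : ∀ t ∈ Set.Icc a b, ∀ i, F t ≤ f i t)
    (hact : ∀ t ∈ Set.Icc a b, ∃ i, F t = f i t)
    (hder : ∀ᵐ t, t ∈ Set.Icc a b → ∃ i d, F t = f i t ∧ HasDerivAt (f i) d t ∧ h t ≤ d)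
    (hh : IntervalIntegrable h volume a b) :
    ∫ t in a..b, h t ≤ F b - F a := by
  have hF : LipschitzOnWith K F (Set.Icc a b) := by
    refine LipschitzOnWith.of_le_add_mul K fun s hs t ht => ?_
    obtain ⟨i, hi⟩ := hact t ht
    have h1 := (hf i).le_add_mul hs ht
    linarith [hle s hs i]
  have hac : AbsolutelyContinuousOnInterval F a b :=
    LipschitzOnWith.absolutelyContinuousOnInterval (K := K) (by rwa [Set.uIcc_of_le hab])
  rw [← hac.integral_deriv_eq_sub]
  refine intervalIntegral.integral_mono_ae_restrict hab hh hac.intervalIntegrable_deriv ?_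
  have ha : ∀ᵐ t : ℝ, t ≠ a := by simp [ae_iff, measure_singleton]
  have hb : ∀ᵐ t : ℝ, t ≠ b := by simp [ae_iff, measure_singleton]
  rw [EventuallyLE, ae_restrict_iff' measurableSet_Icc]
  filter_upwards [ha, hb, hder, hac.ae_differentiableAt] with t hta htb htd htF ht
  obtain ⟨i, d, hi, hd, hhd⟩ := htd ht
  have hFd := (htF (by rwa [Set.uIcc_of_le hab])).hasDerivAt
  have hmin : IsLocalMin (fun s => f i s - F s) t := by
    filter_upwards [Icc_mem_nhds (lt_of_le_of_ne ht.1 hta.symm) (lt_of_le_of_ne ht.2 htb)]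
      with s hs
    have := hle s hs i
    simp only [← hi, sub_self]
    linarith
  have := hmin.hasDerivAt_eq_zero (hd.sub hFd)
  linarith

/-- A trajectory of `ẋ_j = ∑_k a_{jk}(t) (x_k - x_j)`, in integral form. -/
def IsFlow {N : ℕ} (A : ℝ → Matrix (Fin N) (Fin N) ℝ) (x : ℝ → Fin N → ℝ) : Prop :=
  ContinuousOn x (Set.Ici 0) ∧
  ∀ t ∈ Set.Ici (0:ℝ), ∀ j, x t j = x 0 j + ∫ s in (0:ℝ)..t, ∑ k, A s j k * (x s k - x s j)

theorem neg_sLap_mulVec {N : ℕ} {A : Matrix (Fin N) (Fin N) ℝ} (hd : ∀ j, A j j = 0)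
    (hA : ∀ j k, 0 ≤ A j k) (x : Fin N → ℝ) (j : Fin N) :
    -((sLap A).mulVec x j) = ∑ k, A j k * (x k - x j) := by
  have h : ∀ k, sLap A j k * x k
      = (if j = k then (∑ m, A j m) * x j else 0) - A j k * x k := by
    intro k
    by_cases hjk : j = k
    · subst hjk
      simp [sLap, hd, abs_of_nonneg (hA _ _)]
    · simp [sLap, hjk]
  simp only [Matrix.mulVec, dotProduct, h, Finset.sum_sub_distrib, Finset.sum_ite_eq,
    Finset.mem_univ, if_true, mul_sub, Finset.sum_mul]
  ring

theorem isSolution_iff_isFlow {N : ℕ} {A : ℝ → Matrix (Fin N) (Fin N) ℝ} (hA : IsAdjacency A)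
    (hpos : ∀ᵐ t ∂(volume.restrict (Set.Ici (0:ℝ))), ∀ j k, 0 ≤ A t j k)
    (x : ℝ → Fin N → ℝ) : IsSolution A x ↔ IsFlow A x := by
  have key : ∀ t ∈ Set.Ici (0:ℝ), ∀ j,
      ∫ s in (0:ℝ)..t, -((sLap (A s)).mulVec (x s) j)
        = ∫ s in (0:ℝ)..t, ∑ k, A s j k * (x s k - x s j) := by
    intro t ht j
    refine intervalIntegral.integral_congr_ae ?_
    rw [ae_restrict_iff' measurableSet_Ici] at hpos
    filter_upwards [hpos] with s hs hst
    rw [Set.uIoc_of_le ht] at hst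
    exact neg_sLap_mulVec (hA.2.2 s) (hs (Set.mem_Ici.2 hst.1.le)) (x s) j
  unfold IsSolution IsFlow
  refine and_congr_right fun _ => forall₂_congr fun t ht => forall_congr' fun j => ?_
  rw [key t ht j]

theorem IsFlow.affine {N : ℕ} {A : ℝ → Matrix (Fin N) (Fin N) ℝ} {x : ℝ → Fin N → ℝ}
    (hx : IsFlow A x) (c d : ℝ) : IsFlow A fun t j => c + d * x t j := by
  refine ⟨?_, fun t ht j => ?_⟩
  · rw [continuousOn_pi]
    intro j
    have := (continuousOn_pi.1 hx.1) j
    fun_prop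
  · have h : ∀ s, ∑ k, A s j k * (c + d * x s k - (c + d * x s j))
        = d * ∑ k, A s j k * (x s k - x s j) := by
      intro s
      rw [Finset.mul_sum]
      exact Finset.sum_congr rfl fun k _ => by ring
    simp only [h, intervalIntegral.integral_const_mul]
    rw [hx.2 t ht j]
    ring

theorem isFlow_const {N : ℕ} (A : ℝ → Matrix (Fin N) (Fin N) ℝ) (c : ℝ) :
    IsFlow A fun _ _ => c :=
  ⟨continuousOn_const, by simp⟩

section Flow

variable {N : ℕ} {A : ℝ → Matrix (Fin N) (Fin N) ℝ} {x : ℝ → Fin N → ℝ}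

theorem IsAdjacency.intervalIntegrable (hA : IsAdjacency A) {a b : ℝ} (ha : 0 ≤ a) (hab : a ≤ b)
    (j k : Fin N) : IntervalIntegrable (fun t => A t j k) volume a b := by
  obtain ⟨C, hC⟩ := hA.2.1 b
  rw [intervalIntegrable_iff_integrableOn_Icc_of_le hab]
  refine Measure.integrableOn_of_bounded (M := C) (by simp) (hA.1 j k).aestronglyMeasurable ?_
  rw [ae_restrict_iff' measurableSet_Icc]
  exact ae_of_all _ fun t ht => hC t ⟨ha.trans ht.1, ht.2⟩ j k

theorem IsAdjacency.intervalIntegrable_cut (hA : IsAdjacency A) {a b : ℝ} (ha : 0 ≤ a)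
    (hab : a ≤ b) (V : Finset (Fin N)) :
    IntervalIntegrable (fun t => ∑ j ∈ V, ∑ k ∈ Vᶜ, A t j k) volume a b := by
  have h : ∀ j ∈ V, IntervalIntegrable (fun t => ∑ k ∈ Vᶜ, A t j k) volume a b := fun j _ => by
    simpa only [Finset.sum_fn] using
      IntervalIntegrable.sum Vᶜ fun k _ => hA.intervalIntegrable ha hab j k
  simpa only [Finset.sum_fn] using IntervalIntegrable.sum V h

theorem IsFlow.continuousOn_apply (hx : IsFlow A x) (j : Fin N) :
    ContinuousOn (fun t => x t j) (Set.Ici 0) :=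
  continuousOn_pi.1 hx.1 j

theorem IsAdjacency.intervalIntegrable_velocity (hA : IsAdjacency A)
    (hx : ContinuousOn x (Set.Ici 0)) {a b : ℝ} (ha : 0 ≤ a) (hab : a ≤ b) (j : Fin N) :
    IntervalIntegrable (fun s => ∑ k, A s j k * (x s k - x s j)) volume a b := by
  have hsub : Set.uIcc a b ⊆ Set.Ici 0 := by
    rw [Set.uIcc_of_le hab]
    exact fun t ht => ha.trans ht.1
  have h : ∀ k ∈ (Finset.univ : Finset (Fin N)),
      IntervalIntegrable (fun s => A s j k * (x s k - x s j)) volume a b := fun k _ =>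
    (hA.intervalIntegrable ha hab j k).mul_continuousOn
      (((continuousOn_pi.1 hx k).sub (continuousOn_pi.1 hx j)).mono hsub)
  simpa only [Finset.sum_fn] using IntervalIntegrable.sum _ h

theorem IsFlow.sub_eq_integral (hA : IsAdjacency A) (hx : IsFlow A x) {a b : ℝ} (ha : 0 ≤ a)
    (hab : a ≤ b) (j : Fin N) :
    x b j - x a j = ∫ s in a..b, ∑ k, A s j k * (x s k - x s j) := by
  have h0 := hA.intervalIntegrable_velocity hx.1 le_rfl ha j
  have h1 := hA.intervalIntegrable_velocity hx.1 ha hab j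
  rw [hx.2 b (ha.trans hab) j, hx.2 a ha j,
    ← intervalIntegral.integral_add_adjacent_intervals h0 h1]
  ring

theorem IsFlow.exists_lipschitzOnWith (hA : IsAdjacency A) (hx : IsFlow A x) (T : ℝ) :
    ∃ K : NNReal, ∀ j, LipschitzOnWith K (fun t => x t j) (Set.Icc 0 T) := by
  obtain ⟨C, hC⟩ := hA.2.1 T
  obtain ⟨B, hB⟩ := isCompact_Icc.exists_bound_of_continuousOn
    (hx.1.mono (Set.Icc_subset_Ici_self : Set.Icc 0 T ⊆ Set.Ici 0))
  have hv : ∀ s ∈ Set.Icc 0 T, ∀ j,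
      ‖∑ k, A s j k * (x s k - x s j)‖ ≤ ∑ _k : Fin N, |C| * (B + B) := by
    intro s hs j
    refine (norm_sum_le _ _).trans (Finset.sum_le_sum fun k _ => ?_)
    rw [norm_mul]
    have h1 : ‖A s j k‖ ≤ |C| := (hC s hs j k).trans (le_abs_self C)
    have h2 : ‖x s k - x s j‖ ≤ B + B :=
      (norm_sub_le _ _).trans (add_le_add ((norm_le_pi_norm _ _).trans (hB s hs))
        ((norm_le_pi_norm _ _).trans (hB s hs)))
    exact mul_le_mul h1 h2 (norm_nonneg _) (abs_nonneg _)
  refine ⟨(∑ _k : Fin N, |C| * (B + B)).toNNReal, fun j => ?_⟩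
  refine LipschitzOnWith.of_dist_le_mul fun s hs t ht => ?_
  wlog hst : s ≤ t generalizing s t
  · rw [dist_comm, dist_comm s]
    exact this t ht s hs (le_of_not_ge hst)
  have h0 : 0 ≤ ∑ _k : Fin N, |C| * (B + B) := (norm_nonneg _).trans (hv s hs j)
  rw [dist_comm, dist_comm s, Real.dist_eq, Real.dist_eq, hx.sub_eq_integral hA hs.1 hst,
    Real.coe_toNNReal _ h0]
  refine intervalIntegral.norm_integral_le_of_norm_le_const fun u hu => hv u ?_ j
  rw [Set.uIoc_of_le hst] at hu
  exact ⟨hs.1.trans hu.1.le, hu.2.trans ht.2⟩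

theorem IsFlow.ae_hasDerivAt (hA : IsAdjacency A) (hx : IsFlow A x) (T : ℝ) :
    ∀ᵐ t, t ∈ Set.Icc 0 T →
      ∀ j, HasDerivAt (fun t => x t j) (∑ k, A t j k * (x t k - x t j)) t := by
  rcases le_or_gt 0 T with hT | hT
  swap
  · simp [Set.Icc_eq_empty_of_lt hT]
  have h := ae_all_iff.2 fun j =>
    (hA.intervalIntegrable_velocity hx.1 le_rfl hT j).ae_hasDerivAt_integral
  have h0 : ∀ᵐ t : ℝ, t ≠ 0 := by simp [ae_iff, measure_singleton]
  filter_upwards [h, h0] with t ht ht0 htT j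
  rw [Set.uIcc_of_le hT] at ht
  have h1 := ((ht j) htT 0 ⟨le_rfl, hT⟩).const_add (x 0 j)
  refine h1.congr_of_eventuallyEq ?_
  filter_upwards [Ioi_mem_nhds (lt_of_le_of_ne htT.1 ht0.symm)] with s hs
  exact hx.2 s (Set.mem_Ici.2 (le_of_lt hs)) j

/-- Growth of the minimum of finitely many linear functionals along a trajectory. -/
theorem IsFlow.integral_le_sub (hA : IsAdjacency A) (hx : IsFlow A x) {ι : Type*} [Finite ι]
    (c : ι → Fin N → ℝ) {F h : ℝ → ℝ} {a b : ℝ} (ha : 0 ≤ a) (hab : a ≤ b)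
    (hle : ∀ t ∈ Set.Icc a b, ∀ i, F t ≤ ∑ j, c i j * x t j)
    (hact : ∀ t ∈ Set.Icc a b, ∃ i, F t = ∑ j, c i j * x t j)
    (hder : ∀ᵐ t, t ∈ Set.Icc a b → ∃ i, F t = ∑ j, c i j * x t j ∧
      h t ≤ ∑ j, c i j * ∑ k, A t j k * (x t k - x t j))
    (hh : IntervalIntegrable h volume a b) :
    ∫ t in a..b, h t ≤ F b - F a := by
  obtain ⟨K, hK⟩ := hx.exists_lipschitzOnWith hA b
  have := Fintype.ofFinite ι
  have hsub : Set.Icc a b ⊆ Set.Icc 0 b := Set.Icc_subset_Icc_left ha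
  have hlip : ∀ i, LipschitzOnWith ((∑ i, ∑ j, |c i j| * K).toNNReal)
      (fun t => ∑ j, c i j * x t j) (Set.Icc a b) := by
    intro i
    refine LipschitzOnWith.of_dist_le_mul fun s hs t ht => ?_
    rw [Real.coe_toNNReal _ (by positivity), Real.dist_eq, ← Finset.sum_sub_distrib]
    calc |∑ j, (c i j * x s j - c i j * x t j)|
        ≤ ∑ j, |c i j * x s j - c i j * x t j| := Finset.abs_sum_le_sum_abs _ _
      _ ≤ ∑ j, |c i j| * K * dist s t := by
          refine Finset.sum_le_sum fun j _ => ?_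
          rw [← mul_sub, abs_mul, mul_assoc]
          exact mul_le_mul_of_nonneg_left ((hK j).dist_le_mul s (hsub hs) t (hsub ht))
            (abs_nonneg _)
      _ = (∑ j, |c i j| * K) * dist s t := by rw [Finset.sum_mul]
      _ ≤ _ := by
          refine mul_le_mul_of_nonneg_right ?_ dist_nonneg
          exact Finset.single_le_sum (f := fun i => ∑ j, |c i j| * (K : ℝ))
            (fun i _ => by positivity) (Finset.mem_univ i)
  refine integral_le_sub_of_active_deriv_ge hab hlip hle hact ?_ hh
  filter_upwards [hder, hx.ae_hasDerivAt hA b] with t ht hd htab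
  obtain ⟨i, hi, hhi⟩ := ht htab
  exact ⟨i, _, hi, HasDerivAt.fun_sum fun j _ => (hd (hsub htab) j).const_mul _, hhi⟩

/-- The minimum over a set of agents `V` decreases at most by the total weight of the arcs
entering `V`, provided the disagreement across the cut is at most one. -/
theorem IsFlow.sub_integral_cut_le (hA : IsAdjacency A)
    (hpos : ∀ᵐ t ∂(volume.restrict (Set.Ici (0:ℝ))), ∀ j k, 0 ≤ A t j k)
    (hx : IsFlow A x) (V : Finset (Fin N)) {a b m : ℝ} (ha : 0 ≤ a) (hab : a ≤ b)
    (hcut : ∀ t ∈ Set.Icc a b, ∀ j ∈ V, ∀ k ∈ Vᶜ, x t j - x t k ≤ 1)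
    (hm : ∀ j ∈ V, m ≤ x a j) {j : Fin N} (hj : j ∈ V) :
    m - ∫ s in a..b, ∑ j ∈ V, ∑ k ∈ Vᶜ, A s j k ≤ x b j := by
  have hV : V.Nonempty := ⟨j, hj⟩
  have hsum : ∀ (i : V) (z : Fin N → ℝ), ∑ j, (Pi.single (i : Fin N) (1 : ℝ) : Fin N → ℝ) j * z j
      = z i := by
    intro i z
    simp [Pi.single_apply]
  have hint := hA.intervalIntegrable_cut ha hab V
  have key := hx.integral_le_sub hA (ι := V) (fun i => Pi.single (i : Fin N) 1)
    (F := fun t => V.inf' hV (x t)) (h := fun s => -∑ j ∈ V, ∑ k ∈ Vᶜ, A s j k) ha hab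
    (fun t _ i => by rw [hsum]; exact Finset.inf'_le _ i.2)
    (fun t _ => by
      obtain ⟨i, hi, h⟩ := Finset.exists_mem_eq_inf' hV (x t)
      exact ⟨⟨i, hi⟩, by rw [hsum]; exact h⟩) ?_ hint.neg
  · rw [intervalIntegral.integral_neg] at key
    have h1 : m ≤ V.inf' hV (x a) := Finset.le_inf' _ _ hm
    have h2 : V.inf' hV (x b) ≤ x b j := Finset.inf'_le _ hj
    linarith
  · rw [ae_restrict_iff' measurableSet_Ici] at hpos
    filter_upwards [hpos] with t ht htab
    have hp := ht (Set.mem_Ici.2 (ha.trans htab.1))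
    obtain ⟨i, hi, h⟩ := Finset.exists_mem_eq_inf' hV (x t)
    refine ⟨⟨i, hi⟩, by rw [hsum]; exact h, ?_⟩
    rw [hsum]
    have h1 : ∑ k ∈ Vᶜ, A t i k ≤ ∑ j ∈ V, ∑ k ∈ Vᶜ, A t j k :=
      Finset.single_le_sum (f := fun j => ∑ k ∈ Vᶜ, A t j k)
        (fun j _ => Finset.sum_nonneg fun k _ => hp j k) hi
    rw [← Finset.sum_add_sum_compl V]
    have h2 : 0 ≤ ∑ k ∈ V, A t i k * (x t k - x t i) := Finset.sum_nonneg fun k hk =>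
      mul_nonneg (hp i k) (by
        have : V.inf' hV (x t) ≤ x t k := Finset.inf'_le _ hk
        linarith)
    have h3 : -∑ k ∈ Vᶜ, A t i k ≤ ∑ k ∈ Vᶜ, A t i k * (x t k - x t i) := by
      rw [← Finset.sum_neg_distrib]
      refine Finset.sum_le_sum fun k hk => ?_
      nlinarith [hp i k, hcut t htab i hi k hk]
    simp only
    linarith

theorem IsFlow.le_of_le (hA : IsAdjacency A)
    (hpos : ∀ᵐ t ∂(volume.restrict (Set.Ici (0:ℝ))), ∀ j k, 0 ≤ A t j k)
    (hx : IsFlow A x) {a b m : ℝ} (ha : 0 ≤ a) (hab : a ≤ b) (hm : ∀ j, m ≤ x a j) (j : Fin N) :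
    m ≤ x b j := by
  have := hx.sub_integral_cut_le hA hpos Finset.univ ha hab (by simp) (fun j _ => hm j)
    (Finset.mem_univ j)
  simpa using this

theorem IsFlow.ge_of_ge (hA : IsAdjacency A)
    (hpos : ∀ᵐ t ∂(volume.restrict (Set.Ici (0:ℝ))), ∀ j k, 0 ≤ A t j k)
    (hx : IsFlow A x) {a b m : ℝ} (ha : 0 ≤ a) (hab : a ≤ b) (hm : ∀ j, x a j ≤ m) (j : Fin N) :
    x b j ≤ m := by
  have := (hx.affine 0 (-1)).le_of_le hA hpos ha hab (m := -m) (fun j => by linarith [hm j]) j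
  linarith

end Flow

theorem Fin.sub_zero_eq_sum_gap {n : ℕ} (y : Fin (n + 1) → ℝ) (j : Fin (n + 1)) :
    y j - y 0 = ∑ l : Fin n, (y l.succ - y l.castSucc) * (if l.castSucc < j then 1 else 0) := by
  induction j using Fin.induction with
  | zero => simp
  | succ i ih =>
    have h : ∀ l : Fin n, (y l.succ - y l.castSucc) * (if l.castSucc < i.succ then (1:ℝ) else 0)
        = (y l.succ - y l.castSucc) * (if l.castSucc < i.castSucc then 1 else 0)
          + if l = i then y l.succ - y l.castSucc else 0 := by
      intro l
      rcases lt_trichotomy l i with hl | rfl | hl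
      · have h1 : l.castSucc < i.succ := by simp only [Fin.lt_def] at *; simp; omega
        simp [h1, hl, hl.ne]
      · simp
      · have h1 : ¬ l.castSucc < i.succ := by simp only [Fin.lt_def] at *; simp; omega
        simp [h1, hl.not_gt, hl.ne']
    simp only [h, Finset.sum_add_distrib, ← ih, Finset.sum_ite_eq', Finset.mem_univ, if_true]
    ring

theorem sum_cut_eq_sum_ite {ι : Type*} [Fintype ι] [DecidableEq ι] (V : Finset ι)
    (f : ι → ι → ℝ) :
    ∑ i ∈ V, ∑ j ∈ Vᶜ, f i j = ∑ i, ∑ j, if i ∈ V ∧ j ∉ V then f i j else 0 := by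
  rw [← Finset.sum_subset (Finset.subset_univ V)]
  · refine Finset.sum_congr rfl fun i hi => ?_
    rw [← Finset.sum_subset (Finset.subset_univ Vᶜ)]
    · exact Finset.sum_congr rfl fun j hj => by simp [hi, Finset.mem_compl.1 hj]
    · intro j _ hj
      simp only [Finset.mem_compl, not_not] at hj
      simp [hj]
  · intro i _ hi
    simp [hi]

/-- The agents whose rank is at most `l`. -/
def lowRank {n : ℕ} (ρ : Equiv.Perm (Fin (n + 1))) (l : Fin n) : Finset (Fin (n + 1)) :=
  Finset.univ.filter fun i => ρ i ≤ l.castSucc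

/-- Static Lyapunov estimate: for cut-balanced weights and rapidly decaying rank weights `w`, the
weighted sum of the sorted opinions grows at least at the rate given by the flows across the
rank cuts. -/
theorem sum_gap_mul_cut_le {n : ℕ} {a : Fin (n + 1) → Fin (n + 1) → ℝ} {x : Fin (n + 1) → ℝ}
    {ρ : Equiv.Perm (Fin (n + 1))} (hx : Monotone fun i => x (ρ.symm i)) {w : Fin (n + 1) → ℝ}
    (hw : ∀ i, 0 ≤ w i) (hanti : Antitone w) {K : ℝ} (ha : ∀ i j, 0 ≤ a i j)
    (hcut : ∀ V : Finset (Fin (n + 1)), V.Nonempty → V ≠ Finset.univ →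
      ∑ j ∈ V, ∑ k ∈ Vᶜ, a k j ≤ K * ∑ j ∈ V, ∑ k ∈ Vᶜ, a j k) :
    ∑ l : Fin n, (w l.castSucc - K * w l.succ) *
        (x (ρ.symm l.succ) - x (ρ.symm l.castSucc)) *
        ∑ j ∈ lowRank ρ l, ∑ k ∈ (lowRank ρ l)ᶜ, a j k
      ≤ ∑ i, w (ρ i) * ∑ j, a i j * (x j - x i) := by
  set e : Fin n → Fin (n + 1) → ℝ := fun l i => if l.castSucc < ρ i then 1 else 0 with he
  have hdiff : ∀ i j, x j - x i = ∑ l : Fin n,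
      (x (ρ.symm l.succ) - x (ρ.symm l.castSucc)) * (e l j - e l i) := by
    intro i j
    have h1 := Fin.sub_zero_eq_sum_gap (fun i => x (ρ.symm i)) (ρ i)
    have h2 := Fin.sub_zero_eq_sum_gap (fun i => x (ρ.symm i)) (ρ j)
    simp only [Equiv.symm_apply_apply] at h1 h2
    simp only [mul_sub, Finset.sum_sub_distrib, he] at h1 h2 ⊢
    linarith
  have hR : ∑ i, w (ρ i) * ∑ j, a i j * (x j - x i)
      = ∑ l : Fin n, (x (ρ.symm l.succ) - x (ρ.symm l.castSucc)) *
        ∑ i, ∑ j, w (ρ i) * (a i j * (e l j - e l i)) := by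
    have h : ∀ i, w (ρ i) * ∑ j, a i j * (x j - x i)
        = ∑ j, ∑ l : Fin n, (x (ρ.symm l.succ) - x (ρ.symm l.castSucc)) *
          (w (ρ i) * (a i j * (e l j - e l i))) := by
      intro i
      rw [Finset.mul_sum]
      refine Finset.sum_congr rfl fun j _ => ?_
      rw [hdiff i j, Finset.mul_sum, Finset.mul_sum]
      exact Finset.sum_congr rfl fun l _ => by ring
    simp only [h, Finset.mul_sum]
    rw [Finset.sum_comm (s := (Finset.univ : Finset (Fin n)))]
    exact Finset.sum_congr rfl fun i _ => Finset.sum_comm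
  rw [hR]
  refine Finset.sum_le_sum fun l _ => ?_
  set V := lowRank ρ l with hVdef
  have hmem : ∀ i, i ∈ V ↔ ρ i ≤ l.castSucc := fun i => by simp [hVdef, lowRank]
  have hgap : 0 ≤ x (ρ.symm l.succ) - x (ρ.symm l.castSucc) :=
    sub_nonneg.2 (hx (Fin.castSucc_le_succ l))
  have hVne : V.Nonempty := ⟨ρ.symm l.castSucc, by simp [hmem]⟩
  have hVnu : V ≠ Finset.univ := fun h => by
    have := (hmem (ρ.symm l.succ)).1 (h ▸ Finset.mem_univ _)
    simp at this
  have hterm : ∀ i j, w l.castSucc * (if i ∈ V ∧ j ∉ V then a i j else 0)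
      - w l.succ * (if j ∈ V ∧ i ∉ V then a i j else 0)
      ≤ w (ρ i) * (a i j * (e l j - e l i)) := by
    intro i j
    by_cases hi : ρ i ≤ l.castSucc <;> by_cases hj : ρ j ≤ l.castSucc
    · simp [hmem, he, hi, hj, hi.not_gt, hj.not_gt]
    · simp only [hmem, he, hi, hj, hi.not_gt, not_le.1 hj]
      simpa using mul_le_mul_of_nonneg_right (hanti hi) (ha i j)
    · simp only [hmem, he, hi, hj, hj.not_gt, not_le.1 hi]
      have : l.succ ≤ ρ i := Fin.castSucc_lt_iff_succ_le.1 (not_le.1 hi)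
      simpa using mul_le_mul_of_nonneg_right (hanti this) (ha i j)
    · simp [hmem, he, hi, hj, not_le.1 hi, not_le.1 hj]
  have hsum := Finset.sum_le_sum fun i (_ : i ∈ Finset.univ) =>
    Finset.sum_le_sum fun j (_ : j ∈ Finset.univ) => hterm i j
  simp only [Finset.sum_sub_distrib, ← Finset.mul_sum] at hsum
  rw [← sum_cut_eq_sum_ite V a, Finset.sum_comm (f := fun i j =>
    if j ∈ V ∧ i ∉ V then a i j else 0), ← sum_cut_eq_sum_ite V fun j i => a i j] at hsum
  have h1 := mul_le_mul_of_nonneg_left (hcut V hVne hVnu) (hw l.succ)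
  calc (w l.castSucc - K * w l.succ) * (x (ρ.symm l.succ) - x (ρ.symm l.castSucc)) *
        ∑ j ∈ V, ∑ k ∈ Vᶜ, a j k
      = (x (ρ.symm l.succ) - x (ρ.symm l.castSucc)) *
        ((w l.castSucc - K * w l.succ) * ∑ j ∈ V, ∑ k ∈ Vᶜ, a j k) := by ring
    _ ≤ _ := by
      refine mul_le_mul_of_nonneg_left ?_ hgap
      simp only [← Finset.mul_sum]
      linarith

/-- The one-sided form of cut-balance, together with nonnegativity of the weights. -/
def NonnegCutBound {N : ℕ} (A : ℝ → Matrix (Fin N) (Fin N) ℝ) (K : ℝ) : Prop :=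
  ∀ᵐ t ∂(volume.restrict (Set.Ici (0:ℝ))), (∀ j k, 0 ≤ A t j k) ∧
    ∀ V : Finset (Fin N), V.Nonempty → V ≠ Finset.univ →
      ∑ j ∈ V, ∑ k ∈ Vᶜ, A t k j ≤ K * ∑ j ∈ V, ∑ k ∈ Vᶜ, A t j k

theorem CutBalanced.exists_nonnegCutBound {N : ℕ} {A : ℝ → Matrix (Fin N) (Fin N) ℝ}
    (hCB : CutBalanced A)
    (hpos : ∀ᵐ t ∂(volume.restrict (Set.Ici (0:ℝ))), ∀ j k, 0 ≤ A t j k) :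
    ∃ K : ℝ, 1 ≤ K ∧ NonnegCutBound A K := by
  obtain ⟨K, hK, h⟩ := hCB
  refine ⟨K, hK, ?_⟩
  filter_upwards [h, hpos] with t ht hp
  refine ⟨hp, fun V hV hV' => ?_⟩
  have h1 := (ht V hV hV').1
  simp only [abs_of_nonneg (hp _ _)] at h1
  rwa [inv_mul_le_iff₀ (by linarith)] at h1

theorem NonnegCutBound.nonneg {N : ℕ} {A : ℝ → Matrix (Fin N) (Fin N) ℝ} {K : ℝ}
    (h : NonnegCutBound A K) :
    ∀ᵐ t ∂(volume.restrict (Set.Ici (0:ℝ))), ∀ j k, 0 ≤ A t j k :=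
  h.mono fun _ ht => ht.1

/-- The entries of `x` sorted increasingly. -/
noncomputable def sorted {N : ℕ} (x : Fin N → ℝ) (i : Fin N) : ℝ := x (Tuple.sort x i)

theorem sorted_monotone {N : ℕ} (x : Fin N → ℝ) : Monotone (sorted x) :=
  Tuple.monotone_sort x

theorem sum_mul_sorted_le {N : ℕ} {w : Fin N → ℝ} (hw : Antitone w) (x : Fin N → ℝ)
    (ρ : Equiv.Perm (Fin N)) : ∑ i, w i * sorted x i ≤ ∑ j, w (ρ j) * x j := by
  have h := (hw.antivary (sorted_monotone x)).sum_mul_le_sum_mul_comp_perm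
    (σ := ρ.symm.trans (Tuple.sort x).symm)
  refine h.trans (le_of_eq ?_)
  rw [← Equiv.sum_comp ρ]
  simp [sorted]

theorem sum_mul_sorted_eq {N : ℕ} (w : Fin N → ℝ) (x : Fin N → ℝ) :
    ∑ i, w i * sorted x i = ∑ j, w ((Tuple.sort x).symm j) * x j := by
  rw [← Equiv.sum_comp (Tuple.sort x) fun j => w ((Tuple.sort x).symm j) * x j]
  simp [sorted]

section Sorted

variable {n : ℕ} {A : ℝ → Matrix (Fin (n + 1)) (Fin (n + 1)) ℝ} {x : ℝ → Fin (n + 1) → ℝ} {K : ℝ}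

theorem IsFlow.integral_le_sorted_sub (hA : IsAdjacency A) (hK : NonnegCutBound A K)
    (hx : IsFlow A x) {w : Fin (n + 1) → ℝ} (hw : ∀ i, 0 ≤ w i) (hanti : Antitone w)
    {h : ℝ → ℝ} {a b : ℝ} (ha : 0 ≤ a) (hab : a ≤ b)
    (hh : IntervalIntegrable h volume a b)
    (hle : ∀ t ∈ Set.Icc a b, (∀ j k, 0 ≤ A t j k) →
      h t ≤ ∑ l : Fin n, (w l.castSucc - K * w l.succ) *
        (sorted (x t) l.succ - sorted (x t) l.castSucc) *
        ∑ j ∈ lowRank (Tuple.sort (x t)).symm l,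
          ∑ k ∈ (lowRank (Tuple.sort (x t)).symm l)ᶜ, A t j k) :
    ∫ t in a..b, h t ≤ ∑ i, w i * sorted (x b) i - ∑ i, w i * sorted (x a) i := by
  refine hx.integral_le_sub hA (fun (ρ : Equiv.Perm (Fin (n + 1))) j => w (ρ j))
    (F := fun t => ∑ i, w i * sorted (x t) i) ha hab
    (fun t _ ρ => sum_mul_sorted_le hanti _ ρ)
    (fun t _ => ⟨_, sum_mul_sorted_eq w (x t)⟩) ?_ hh
  have hK' := hK
  rw [NonnegCutBound, ae_restrict_iff' measurableSet_Ici] at hK'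
  filter_upwards [hK'] with t ht htab
  obtain ⟨hp, hc⟩ := ht (Set.mem_Ici.2 (ha.trans htab.1))
  refine ⟨_, sum_mul_sorted_eq w (x t), (hle t htab hp).trans ?_⟩
  exact sum_gap_mul_cut_le (ρ := (Tuple.sort (x t)).symm) (x := x t)
    (Tuple.monotone_sort (x t)) hw hanti hp hc

/-- Truncated geometric weights. -/
noncomputable def geomWeight (n : ℕ) (K : ℝ) (m : ℕ) (i : Fin (n + 1)) : ℝ :=
  if (i : ℕ) < m then (2 * K)⁻¹ ^ (i : ℕ) else 0

theorem geomWeight_nonneg (hK : 1 ≤ K) (m : ℕ) (i : Fin (n + 1)) : 0 ≤ geomWeight n K m i := by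
  unfold geomWeight
  split_ifs <;> positivity

theorem geomWeight_antitone (hK : 1 ≤ K) (m : ℕ) : Antitone (geomWeight n K m) := by
  intro i j hij
  have h1 : (2 * K)⁻¹ ≤ 1 := inv_le_one_of_one_le₀ (by linarith)
  by_cases hj : (j : ℕ) < m
  · have hi : (i : ℕ) < m := lt_of_le_of_lt hij hj
    simp only [geomWeight, hi, hj, if_true]
    exact pow_le_pow_of_le_one (by positivity) h1 hij
  · rw [geomWeight, if_neg hj]
    exact geomWeight_nonneg hK m i

theorem geomWeight_sub_nonneg (hK : 1 ≤ K) (m : ℕ) (l : Fin n) :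
    0 ≤ geomWeight n K m l.castSucc - K * geomWeight n K m l.succ := by
  by_cases hj : (l.succ : ℕ) < m
  · have hi : (l.castSucc : ℕ) < m := by simp at hj ⊢; omega
    simp only [geomWeight, hi, hj, if_true]
    have h2 : K * (2 * K)⁻¹ = 1 / 2 := by field_simp
    have h3 : 0 ≤ (2 * K)⁻¹ ^ (l : ℕ) := by positivity
    simp only [Fin.val_castSucc, Fin.val_succ, pow_succ]
    nlinarith
  · rw [show geomWeight n K m l.succ = 0 from if_neg hj]
    simpa using geomWeight_nonneg hK m _

theorem geomWeight_sub_pos (hK : 1 ≤ K) (l : Fin n) :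
    0 < geomWeight n K (n + 1) l.castSucc - K * geomWeight n K (n + 1) l.succ := by
  have hj : (l.succ : ℕ) < n + 1 := l.succ.2
  have hi : (l.castSucc : ℕ) < n + 1 := l.castSucc.2
  simp only [geomWeight, hi, hj, if_true]
  have h2 : K * (2 * K)⁻¹ = 1 / 2 := by field_simp
  have h3 : 0 < (2 * K)⁻¹ ^ (l : ℕ) := by positivity
  simp only [Fin.val_castSucc, Fin.val_succ, pow_succ]
  nlinarith

theorem IsFlow.exists_abs_le (hA : IsAdjacency A) (hK : NonnegCutBound A K) (hx : IsFlow A x) :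
    ∃ B, ∀ t, 0 ≤ t → ∀ j, |x t j| ≤ B := by
  refine ⟨‖x 0‖, fun t ht j => abs_le.2 ⟨?_, ?_⟩⟩
  · exact hx.le_of_le hA hK.nonneg le_rfl ht
      (fun j => (abs_le.1 (norm_le_pi_norm (x 0) j)).1) j
  · exact hx.ge_of_ge hA hK.nonneg le_rfl ht
      (fun j => (abs_le.1 (norm_le_pi_norm (x 0) j)).2) j

theorem IsFlow.exists_sum_sorted_le (hA : IsAdjacency A) (hK : NonnegCutBound A K)
    (hx : IsFlow A x) {w : Fin (n + 1) → ℝ} (hw : ∀ i, 0 ≤ w i) :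
    ∃ B, ∀ t, 0 ≤ t → ∑ i, w i * sorted (x t) i ≤ B := by
  obtain ⟨B, hB⟩ := hx.exists_abs_le hA hK
  exact ⟨∑ i, w i * B, fun t ht => Finset.sum_le_sum fun i _ =>
    mul_le_mul_of_nonneg_left ((le_abs_self _).trans (hB t ht _)) (hw i)⟩

theorem IsFlow.tendsto_sum_sorted (hA : IsAdjacency A) (hK1 : 1 ≤ K) (hK : NonnegCutBound A K)
    (hx : IsFlow A x) (m : ℕ) :
    ∃ c, Tendsto (fun t => ∑ i, geomWeight n K m i * sorted (x t) i) atTop (𝓝 c) := by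
  have hw := geomWeight_nonneg (n := n) hK1 m
  obtain ⟨B, hB⟩ := hx.exists_sum_sorted_le hA hK hw
  set S : ℝ → ℝ := fun t => ∑ i, geomWeight n K m i * sorted (x t) i with hS
  have hmono : Monotone fun t => S (max t 0) := by
    intro s t hst
    have h := hx.integral_le_sorted_sub hA hK hw (geomWeight_antitone hK1 m) (h := fun _ => 0)
      (le_max_right s 0) (max_le_max_right 0 hst) intervalIntegrable_const
      (fun t _ hp => Finset.sum_nonneg fun l _ => mul_nonneg (mul_nonneg
        (geomWeight_sub_nonneg hK1 m l)
        (sub_nonneg.2 (sorted_monotone _ (Fin.castSucc_le_succ l))))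
        (Finset.sum_nonneg fun j _ => Finset.sum_nonneg fun k _ => hp j k))
    simp only [intervalIntegral.integral_zero] at h
    exact sub_nonneg.1 h
  have hbdd : BddAbove (Set.range fun t => S (max t 0)) :=
    ⟨B, by rintro _ ⟨t, rfl⟩; exact hB _ (le_max_right _ _)⟩
  refine ⟨_, (tendsto_atTop_ciSup hmono hbdd).congr' ?_⟩
  filter_upwards [eventually_ge_atTop 0] with t ht
  simp [max_eq_left ht]

theorem IsFlow.tendsto_sorted (hA : IsAdjacency A) (hK1 : 1 ≤ K) (hK : NonnegCutBound A K)
    (hx : IsFlow A x) (i : Fin (n + 1)) : ∃ c, Tendsto (fun t => sorted (x t) i) atTop (𝓝 c) := by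
  obtain ⟨c, hc⟩ := hx.tendsto_sum_sorted hA hK1 hK i
  obtain ⟨d, hd⟩ := hx.tendsto_sum_sorted hA hK1 hK (i + 1)
  have hr : (2 * K)⁻¹ ^ (i : ℕ) ≠ 0 := by positivity
  refine ⟨_, ((hd.sub hc).div_const ((2 * K)⁻¹ ^ (i : ℕ))).congr fun t => ?_⟩
  rw [div_eq_iff hr, ← Finset.sum_sub_distrib, Finset.sum_eq_single i]
  · simp [geomWeight]
    ring
  · intro j _ hj
    have : (j : ℕ) < i + 1 ↔ (j : ℕ) < i := by
      have := Fin.val_ne_of_ne hj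
      omega
    simp [geomWeight, this]
  · simp

theorem not_essArc_iff_integrableOn {N : ℕ} {A : ℝ → Matrix (Fin N) (Fin N) ℝ}
    (hA : IsAdjacency A) (j k : Fin N) :
    ¬ EssArc A j k ↔ IntegrableOn (fun t => A t j k) (Set.Ici 0) := by
  rw [EssArc, ← ne_eq, ← lt_top_iff_ne_top, IntegrableOn, Integrable,
    and_iff_right (hA.1 j k).aestronglyMeasurable, hasFiniteIntegral_iff_norm]
  rfl

/-- If `V` is eventually the set of agents below a persistent gap, then no arc entering `V` from
its complement is essential. -/
theorem IsFlow.not_essArc_of_gap (hA : IsAdjacency A) (hK1 : 1 ≤ K) (hK : NonnegCutBound A K)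
    (hx : IsFlow A x) (l : Fin n) {T u v : ℝ} (hT : 0 ≤ T) (huv : u < v)
    (V : Finset (Fin (n + 1)))
    (hV : ∀ t, T ≤ t → lowRank (Tuple.sort (x t)).symm l = V)
    (hu : ∀ t, T ≤ t → sorted (x t) l.castSucc < u)
    (hv : ∀ t, T ≤ t → v < sorted (x t) l.succ) {j k : Fin (n + 1)} (hj : j ∈ V) (hk : k ∉ V) :
    ¬ EssArc A j k := by
  set w := geomWeight n K (n + 1) with hw
  obtain ⟨B, hB⟩ := hx.exists_sum_sorted_le hA hK (geomWeight_nonneg (n := n) hK1 (n + 1))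
  set c := (w l.castSucc - K * w l.succ) * (v - u) with hc
  have hcpos : 0 < c := mul_pos (geomWeight_sub_pos hK1 l) (sub_pos.2 huv)
  have hpos := hK.nonneg
  rw [ae_restrict_iff' measurableSet_Ici] at hpos
  have hbound : ∀ b, T ≤ b →
      ∫ t in T..b, ‖A t j k‖ ≤ (B - ∑ i, w i * sorted (x T) i) / c := by
    intro b hb
    have hint := (hA.intervalIntegrable_cut hT hb V).const_mul c
    have h1 := hx.integral_le_sorted_sub hA hK (geomWeight_nonneg hK1 (n + 1))
      (geomWeight_antitone hK1 (n + 1)) hT hb hint (fun t ht hp => by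
        have hterm : ∀ l' : Fin n, 0 ≤ (w l'.castSucc - K * w l'.succ) *
            (sorted (x t) l'.succ - sorted (x t) l'.castSucc) *
            ∑ j ∈ lowRank (Tuple.sort (x t)).symm l',
              ∑ k ∈ (lowRank (Tuple.sort (x t)).symm l')ᶜ, A t j k := fun l' =>
          mul_nonneg (mul_nonneg (geomWeight_sub_nonneg hK1 _ l')
            (sub_nonneg.2 (sorted_monotone _ (Fin.castSucc_le_succ l'))))
            (Finset.sum_nonneg fun j _ => Finset.sum_nonneg fun k _ => hp j k)
        refine le_trans ?_ (Finset.single_le_sum (fun l' _ => hterm l') (Finset.mem_univ l))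
        rw [hV t ht.1, hc]
        refine mul_le_mul_of_nonneg_right (mul_le_mul_of_nonneg_left ?_
          (geomWeight_sub_nonneg hK1 _ l))
          (Finset.sum_nonneg fun j _ => Finset.sum_nonneg fun k _ => hp j k)
        linarith [hu t ht.1, hv t ht.1])
    have h2 : ∫ t in T..b, ‖A t j k‖ ≤ ∫ t in T..b, ∑ j ∈ V, ∑ k ∈ Vᶜ, A t j k := by
      refine intervalIntegral.integral_mono_ae_restrict hb (hA.intervalIntegrable hT hb j k).norm
        (hA.intervalIntegrable_cut hT hb V) ?_
      rw [EventuallyLE, ae_restrict_iff' measurableSet_Icc]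
      filter_upwards [hpos] with t ht htb
      have hp := ht (Set.mem_Ici.2 (hT.trans htb.1))
      rw [Real.norm_of_nonneg (hp j k)]
      exact (Finset.single_le_sum (f := fun k => A t j k) (fun k _ => hp j k)
        (Finset.mem_compl.2 hk)).trans (Finset.single_le_sum (f := fun j => ∑ k ∈ Vᶜ, A t j k)
        (fun j _ => Finset.sum_nonneg fun k _ => hp j k) hj)
    rw [intervalIntegral.integral_const_mul] at h1
    rw [le_div_iff₀ hcpos]
    have h3 := hB b (hT.trans hb)
    have h4 := mul_le_mul_of_nonneg_left h2 hcpos.le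
    linarith
  have hIoi : IntegrableOn (fun t => A t j k) (Set.Ioi T) := by
    refine integrableOn_Ioi_of_intervalIntegral_norm_bounded
      ((B - ∑ i, w i * sorted (x T) i) / c) T (b := id) (l := atTop) (fun b => ?_) tendsto_id ?_
    · rcases le_or_gt T b with hb | hb
      · exact (intervalIntegrable_iff_integrableOn_Ioc_of_le hb).1
          (hA.intervalIntegrable hT hb j k)
      · simp [Set.Ioc_eq_empty_of_le hb.le]
    · filter_upwards [eventually_ge_atTop T] with b hb using hbound b hb
  rw [not_essArc_iff_integrableOn hA, ← Set.Icc_union_Ioi_eq_Ici hT]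
  exact ((intervalIntegrable_iff_integrableOn_Icc_of_le hT).1
    (hA.intervalIntegrable le_rfl hT j k)).union hIoi

/-- In a strongly connected essential graph, every proper nonempty set of agents is entered by an
essential arc. -/
theorem exists_essArc_of_essReach {N : ℕ} {A : ℝ → Matrix (Fin N) (Fin N) ℝ}
    (h : ∀ u v, EssReach A u v) {V : Finset (Fin N)} {j k : Fin N} (hj : j ∈ V) (hk : k ∉ V) :
    ∃ j' ∈ V, ∃ k', k' ∉ V ∧ EssArc A j' k' := by
  by_contra! hcon
  have : ∀ v, EssReach A k v → v ∉ V := by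
    intro v hv
    induction hv with
    | refl => exact hk
    | tail _ hbc ih => exact fun hc => hcon _ hc _ ih hbc
  exact this j (h k j) hj

theorem IsFlow.exists_tendsto_of_essReach (hA : IsAdjacency A) (hK1 : 1 ≤ K)
    (hK : NonnegCutBound A K) (hx : IsFlow A x) (hconn : ∀ u v, EssReach A u v) :
    ∃ c : ℝ, ∀ i, Tendsto (fun t => x t i) atTop (𝓝 c) := by
  choose y hy using hx.tendsto_sorted hA hK1 hK
  have hgap : ∀ l : Fin n, y l.succ = y l.castSucc := by
    intro l
    have hle : y l.castSucc ≤ y l.succ := le_of_tendsto_of_tendsto' (hy _) (hy _)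
      fun t => sorted_monotone _ (Fin.castSucc_le_succ l)
    by_contra hne
    have hlt : y l.castSucc < y l.succ := lt_of_le_of_ne hle (Ne.symm hne)
    obtain ⟨u, hyu, huy⟩ := exists_between hlt
    obtain ⟨v, huv, hvy⟩ := exists_between huy
    obtain ⟨T, hT⟩ := eventually_atTop.1 (((hy l.castSucc).eventually_lt_const hyu).and
      (((hy l.succ).eventually_const_lt hvy).and (eventually_ge_atTop 0)))
    have hT0 : 0 ≤ T := (hT T le_rfl).2.2
    have hlow : ∀ t, ∀ a, a ∈ lowRank (Tuple.sort (x t)).symm l → x t a ≤ sorted (x t) l.castSucc := by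
      intro t a ha
      have := sorted_monotone (x t) ((Finset.mem_filter.1 ha).2)
      simpa [sorted] using this
    have hhigh : ∀ t, ∀ a, a ∉ lowRank (Tuple.sort (x t)).symm l → sorted (x t) l.succ ≤ x t a := by
      intro t a ha
      have h1 : l.castSucc < (Tuple.sort (x t)).symm a := by simpa [lowRank] using ha
      have := sorted_monotone (x t) (Fin.castSucc_lt_iff_succ_le.1 h1)
      simpa [sorted] using this
    have hmem : ∀ t, T ≤ t → ∀ a, a ∈ lowRank (Tuple.sort (x t)).symm l ↔ x t a < v := by
      intro t ht a
      refine ⟨fun ha => ((hlow t a ha).trans_lt (hT t ht).1).trans huv, fun ha => ?_⟩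
      by_contra hna
      exact absurd (((hT t ht).2.1.trans_le (hhigh t a hna)).trans ha) (lt_irrefl _)
    have hne' : ∀ t, T ≤ t → ∀ a, x t a ≠ v := by
      intro t ht a
      by_cases ha : a ∈ lowRank (Tuple.sort (x t)).symm l
      · exact ((hmem t ht a).1 ha).ne
      · exact ((hT t ht).2.1.trans_le (hhigh t a ha)).ne'
    have hconst : ∀ t, T ≤ t → ∀ a, x t a < v ↔ x T a < v := by
      intro t ht a
      have hcont : ContinuousOn (fun t => x t a) (Set.Icc T t) :=
        (hx.continuousOn_apply a).mono fun s hs => hT0.trans hs.1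
      constructor
      · intro h
        by_contra! h'
        obtain ⟨s, hs, hsv⟩ := intermediate_value_Icc' ht hcont ⟨h.le, h'⟩
        exact hne' s hs.1 a hsv
      · intro h
        by_contra! h'
        obtain ⟨s, hs, hsv⟩ := intermediate_value_Icc ht hcont ⟨h.le, h'⟩
        exact hne' s hs.1 a hsv
    set V := lowRank (Tuple.sort (x T)).symm l with hVdef
    have hV : ∀ t, T ≤ t → lowRank (Tuple.sort (x t)).symm l = V := by
      intro t ht
      ext a
      rw [hmem t ht, hconst t ht, hmem T le_rfl]
    obtain ⟨j, hj, k, hk, hjk⟩ := exists_essArc_of_essReach hconn (V := V)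
      (j := Tuple.sort (x T) l.castSucc) (k := Tuple.sort (x T) l.succ)
      (by simp [hVdef, lowRank]) (by simp [hVdef, lowRank])
    exact hx.not_essArc_of_gap hA hK1 hK l hT0 huv V hV (fun t ht => (hT t ht).1)
      (fun t ht => (hT t ht).2.1) hj hk hjk
  have hy0 : ∀ i, y i = y 0 := by
    intro i
    induction i using Fin.induction with
    | zero => rfl
    | succ i ih => rw [hgap, ih]
  refine ⟨y 0, fun i => ?_⟩
  have hlast := hy (Fin.last n)
  rw [hy0] at hlast
  refine tendsto_of_tendsto_of_tendsto_of_le_of_le (hy 0) hlast (fun t => ?_) (fun t => ?_)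
  · simpa [sorted] using sorted_monotone (x t) (Fin.zero_le ((Tuple.sort (x t)).symm i))
  · simpa [sorted] using sorted_monotone (x t) (Fin.le_last ((Tuple.sort (x t)).symm i))

end Sorted

section Existence

variable {N : ℕ} {A : ℝ → Matrix (Fin N) (Fin N) ℝ}

/-- The terms of the Picard series of `ẋ_j = ∑_k a_{jk}(t) (x_k - x_j)` with value `v` at `t₀`. -/
noncomputable def picardTerm (A : ℝ → Matrix (Fin N) (Fin N) ℝ) (t₀ : ℝ) (v : Fin N → ℝ) :
    ℕ → ℝ → Fin N → ℝ
  | 0 => fun _ => v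
  | n + 1 => fun t j =>
    ∫ s in t₀..t, ∑ k, A s j k * (picardTerm A t₀ v n s k - picardTerm A t₀ v n s j)

theorem continuousOn_Ici_of_continuousOn_Icc {E : Type*} [TopologicalSpace E] {f : ℝ → E}
    (h : ∀ T, ContinuousOn f (Set.Icc 0 T)) : ContinuousOn f (Set.Ici 0) := fun t ht =>
  (h (t + 1) t ⟨ht, by linarith⟩).mono_of_mem_nhdsWithin <| by
    filter_upwards [self_mem_nhdsWithin, mem_nhdsWithin_of_mem_nhds (Iio_mem_nhds (lt_add_one t))]
      with s hs hst using ⟨hs, le_of_lt hst⟩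

theorem IsAdjacency.intervalIntegrable_velocity_of_nonneg (hA : IsAdjacency A) {x : ℝ → Fin N → ℝ}
    (hx : ContinuousOn x (Set.Ici 0)) {a b : ℝ} (ha : 0 ≤ a) (hb : 0 ≤ b) (j : Fin N) :
    IntervalIntegrable (fun s => ∑ k, A s j k * (x s k - x s j)) volume a b :=
  (hA.intervalIntegrable_velocity hx le_rfl ha j).symm.trans
    (hA.intervalIntegrable_velocity hx le_rfl hb j)

theorem continuousOn_picardTerm (hA : IsAdjacency A) {t₀ : ℝ} (ht₀ : 0 ≤ t₀) (v : Fin N → ℝ)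
    (n : ℕ) : ContinuousOn (picardTerm A t₀ v n) (Set.Ici 0) := by
  induction n with
  | zero => exact continuousOn_const
  | succ n ih =>
    refine continuousOn_pi.2 fun j => continuousOn_Ici_of_continuousOn_Icc fun T => ?_
    have hM : (0:ℝ) ≤ max T t₀ := ht₀.trans (le_max_right _ _)
    have h := intervalIntegral.continuousOn_primitive_interval'
      (hA.intervalIntegrable_velocity ih le_rfl hM j) (a := t₀)
      (by rw [Set.uIcc_of_le hM]; exact ⟨ht₀, le_max_right _ _⟩)
    rw [Set.uIcc_of_le hM] at h
    exact h.mono (Set.Icc_subset_Icc_right (le_max_left _ _))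

theorem abs_velocity_le {C M : ℝ} (hC : 0 ≤ C) {a : Matrix (Fin N) (Fin N) ℝ} {z : Fin N → ℝ}
    (ha : ∀ j k, |a j k| ≤ C) (hz : ∀ j, |z j| ≤ M) (j : Fin N) :
    |∑ k, a j k * (z k - z j)| ≤ N * C * 2 * M := by
  calc |∑ k, a j k * (z k - z j)| ≤ ∑ k, |a j k * (z k - z j)| := Finset.abs_sum_le_sum_abs _ _
    _ ≤ ∑ _k : Fin N, C * (M + M) := by
        refine Finset.sum_le_sum fun k _ => ?_
        rw [abs_mul]
        exact mul_le_mul (ha j k) ((abs_sub _ _).trans (add_le_add (hz k) (hz j)))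
          (abs_nonneg _) hC
    _ = _ := by simp; ring

theorem abs_picardTerm_le {t₀ T C : ℝ} (ht₀ : t₀ ∈ Set.Icc 0 T) (hC0 : 0 ≤ C)
    (hC : ∀ t ∈ Set.Icc (0:ℝ) T, ∀ j k, |A t j k| ≤ C) (v : Fin N → ℝ) (n : ℕ) :
    ∀ t ∈ Set.Icc 0 T, ∀ j,
      |picardTerm A t₀ v n t j| ≤ ‖v‖ * ((N * C * 2) ^ n * |t - t₀| ^ n / n.factorial) := by
  induction n with
  | zero =>
    intro t _ j
    simpa [picardTerm] using norm_le_pi_norm v j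
  | succ n ih =>
    intro t ht j
    set L : ℝ := N * C * 2 with hL
    have hsub : Set.uIoc t₀ t ⊆ Set.Icc 0 T :=
      Set.uIoc_subset_uIcc.trans (Set.ordConnected_Icc.uIcc_subset ht₀ ht)
    have hg : IntervalIntegrable (fun s => ‖v‖ * L ^ (n + 1) / n.factorial * |s - t₀| ^ n)
        volume t₀ t := Continuous.intervalIntegrable (by fun_prop) _ _
    have h := intervalIntegral.norm_integral_le_abs_of_norm_le
      (f := fun s => ∑ k, A s j k * (picardTerm A t₀ v n s k - picardTerm A t₀ v n s j))
      (a := t₀) (b := t) (μ := volume)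
      (g := fun s => ‖v‖ * L ^ (n + 1) / n.factorial * |s - t₀| ^ n) (by
        rw [ae_restrict_iff' measurableSet_uIoc]
        refine ae_of_all _ fun s hs => ?_
        refine (abs_velocity_le hC0 (hC s (hsub hs)) (ih s (hsub hs)) j).trans (le_of_eq ?_)
        rw [← hL]
        ring) hg
    refine h.trans (le_of_eq ?_)
    have hLn : 0 ≤ L := by positivity
    rw [intervalIntegral.integral_const_mul, abs_mul, intervalIntegral.abs_intervalIntegral_eq,
      integral_pow_abs_sub_uIoc, abs_of_nonneg (by positivity), abs_of_nonneg (by positivity),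
      Nat.factorial_succ]
    push_cast
    field_simp

theorem exists_isFlow (hA : IsAdjacency A) {t₀ : ℝ} (ht₀ : 0 ≤ t₀) (v : Fin N → ℝ) :
    ∃ x, IsFlow A x ∧ x t₀ = v := by
  set y := picardTerm A t₀ v with hy
  have hbound : ∀ T, ∃ u : ℕ → ℝ, Summable u ∧ ∀ n, ∀ t ∈ Set.Icc 0 T, ∀ j, |y n t j| ≤ u n := by
    intro T
    obtain ⟨C, hC⟩ := hA.2.1 (max T t₀)
    refine ⟨fun n => ‖v‖ * ((N * |C| * 2 * max T t₀) ^ n / n.factorial),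
      (Real.summable_pow_div_factorial _).mul_left _, fun n t ht j => ?_⟩
    have ht' : t ∈ Set.Icc 0 (max T t₀) := ⟨ht.1, ht.2.trans (le_max_left _ _)⟩
    have h := abs_picardTerm_le ⟨ht₀, le_max_right T t₀⟩ (abs_nonneg C)
      (fun t ht j k => (hC t ht j k).trans (le_abs_self C)) v n t ht' j
    refine h.trans ?_
    beta_reduce
    rw [mul_pow (N * |C| * 2 : ℝ) (max T t₀)]
    have h1 : |t - t₀| ≤ max T t₀ := by
      rw [abs_le]
      constructor <;> linarith [ht'.1, ht'.2, le_max_right T t₀]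
    gcongr
  have hsummable : ∀ t, 0 ≤ t → ∀ j, Summable fun n => y n t j := by
    intro t ht j
    obtain ⟨u, hu, hyu⟩ := hbound t
    exact Summable.of_norm_bounded hu fun n => hyu n t ⟨ht, le_rfl⟩ j
  set x : ℝ → Fin N → ℝ := fun t j => ∑' n, y n t j with hx
  have hcont : ContinuousOn x (Set.Ici 0) := by
    refine continuousOn_pi.2 fun j => continuousOn_Ici_of_continuousOn_Icc fun T => ?_
    obtain ⟨u, hu, hyu⟩ := hbound T
    exact continuousOn_tsum
      (fun n => (continuousOn_pi.1 (continuousOn_picardTerm hA ht₀ v n) j).mono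
        Set.Icc_subset_Ici_self) hu fun n t ht => hyu n t ht j
  have hint : ∀ t, 0 ≤ t → ∀ j,
      x t j = v j + ∫ s in t₀..t, ∑ k, A s j k * (x s k - x s j) := by
    intro t ht j
    set T := max t t₀ with hT
    obtain ⟨C, hC⟩ := hA.2.1 T
    obtain ⟨u, hu, hyu⟩ := hbound T
    have hsub : Set.uIoc t₀ t ⊆ Set.Icc 0 T :=
      Set.uIoc_subset_uIcc.trans (Set.ordConnected_Icc.uIcc_subset ⟨ht₀, le_max_right _ _⟩
        ⟨ht, le_max_left _ _⟩)
    have hsum : HasSum (fun n => ∫ s in t₀..t, ∑ k, A s j k * (y n s k - y n s j))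
        (∫ s in t₀..t, ∑ k, A s j k * (x s k - x s j)) := by
      refine intervalIntegral.hasSum_integral_of_dominated_convergence
        (fun n _ => N * |C| * 2 * u n) (fun n => ?_) (fun n => ae_of_all _ fun s hs => ?_)
        (ae_of_all _ fun s _ => hu.mul_left _) intervalIntegrable_const
        (ae_of_all _ fun s hs => ?_)
      · exact (intervalIntegrable_iff.1 (IsAdjacency.intervalIntegrable_velocity_of_nonneg hA
          (continuousOn_picardTerm hA ht₀ v n) ht₀ ht j)).aestronglyMeasurable
      · exact abs_velocity_le (abs_nonneg C)
          (fun j k => (hC s (hsub hs) j k).trans (le_abs_self C)) (hyu n s (hsub hs)) j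
      · have hs0 := (hsub hs).1
        exact hasSum_sum fun k _ => ((hsummable s hs0 k).hasSum.sub
          (hsummable s hs0 j).hasSum).mul_left _
    change ∑' n, y n t j = _
    rw [(hsummable t ht j).tsum_eq_zero_add]
    congr 1
    exact hsum.tsum_eq
  refine ⟨x, ⟨hcont, fun t ht j => ?_⟩, funext fun j => by simp [hint t₀ ht₀ j]⟩
  rw [hint t ht j, hint 0 le_rfl j, add_assoc, intervalIntegral.integral_add_adjacent_intervals
    (IsAdjacency.intervalIntegrable_velocity_of_nonneg hA hcont ht₀ le_rfl j)
    (IsAdjacency.intervalIntegrable_velocity_of_nonneg hA hcont le_rfl ht j)]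

end Existence

theorem NonnegCutBound.integrableOn_cut {N : ℕ} {A : ℝ → Matrix (Fin N) (Fin N) ℝ} {K : ℝ}
    (hA : IsAdjacency A) (hK : NonnegCutBound A K) {V : Finset (Fin N)}
    (hV : V.Nonempty) (hVu : V ≠ Finset.univ)
    (h : IntegrableOn (fun t => ∑ j ∈ V, ∑ k ∈ Vᶜ, A t j k) (Set.Ici 0)) :
    IntegrableOn (fun t => ∑ j ∈ Vᶜ, ∑ k ∈ V, A t j k) (Set.Ici 0) := by
  refine (h.const_mul K).mono' ?_ ?_
  · exact (Finset.measurable_fun_sum _ fun j _ =>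
      Finset.measurable_fun_sum _ fun k _ => hA.1 j k).aestronglyMeasurable
  · filter_upwards [hK] with t ht
    rw [Real.norm_of_nonneg (Finset.sum_nonneg fun j _ => Finset.sum_nonneg fun k _ => ht.1 j k)]
    exact (le_of_eq Finset.sum_comm).trans (ht.2 V hV hVu)

theorem exists_tail_integral_lt {f : ℝ → ℝ} (hf : IntegrableOn f (Set.Ici 0)) {ε : ℝ}
    (hε : 0 < ε) : ∃ T, ∀ a, T ≤ a → 0 ≤ a ∧ ∀ b, a ≤ b → ∫ t in a..b, f t < ε := by
  have hlim := intervalIntegral_tendsto_integral_Ioi 0 (hf.mono_set Set.Ioi_subset_Ici_self)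
    tendsto_id
  obtain ⟨T, hT⟩ := eventually_atTop.1
    ((Metric.tendsto_nhds.1 hlim (ε / 2) (half_pos hε)).and (eventually_ge_atTop 0))
  refine ⟨T, fun a ha => ⟨(hT a ha).2, fun b hab => ?_⟩⟩
  have h1 := (hT a ha).1
  have h2 := (hT b (ha.trans hab)).1
  have hi : ∀ b, 0 ≤ b → IntervalIntegrable f volume 0 b := fun b hb =>
    (intervalIntegrable_iff_integrableOn_Icc_of_le hb).2 (hf.mono_set Set.Icc_subset_Ici_self)
  have h3 := intervalIntegral.integral_interval_sub_left (hi b ((hT a ha).2.trans hab))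
    (hi a (hT a ha).2)
  simp only [id, Real.dist_eq, abs_lt] at h1 h2
  linarith [h1.1, h2.2]

theorem essReach_of_consensus {N : ℕ} {A : ℝ → Matrix (Fin N) (Fin N) ℝ} {K : ℝ}
    (hA : IsAdjacency A) (hK : NonnegCutBound A K)
    (hcons : ∀ x : ℝ → Fin N → ℝ, IsFlow A x →
      ∃ c : ℝ, ∀ i, Tendsto (fun t => x t i) atTop (𝓝 c)) (u v : Fin N) : EssReach A u v := by
  classical
  by_contra huv
  set V : Finset (Fin N) := Finset.univ.filter fun w => ¬ EssReach A u w with hVdef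
  have hvV : v ∈ V := by simp [hVdef, huv]
  have huV : u ∉ V := fun h => (Finset.mem_filter.1 h).2 Relation.ReflTransGen.refl
  have hVu : V ≠ Finset.univ := fun h => huV (h ▸ Finset.mem_univ u)
  have hint : IntegrableOn (fun t => ∑ j ∈ V, ∑ k ∈ Vᶜ, A t j k) (Set.Ici 0) := by
    refine integrable_finsetSum _ fun j hj => integrable_finsetSum _ fun k hk => ?_
    refine (not_essArc_iff_integrableOn hA j k).1 fun hjk => ?_
    have hj' : ¬ EssReach A u j := by simpa [hVdef] using hj
    have hk' : EssReach A u k := by simpa [hVdef] using hk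
    exact hj' (Relation.ReflTransGen.tail hk' hjk)
  have hint' := hK.integrableOn_cut hA ⟨v, hvV⟩ hVu hint
  obtain ⟨T₁, hT₁⟩ := exists_tail_integral_lt hint (ε := 1 / 4) (by norm_num)
  obtain ⟨T₂, hT₂⟩ := exists_tail_integral_lt hint' (ε := 1 / 4) (by norm_num)
  set a := max T₁ T₂
  have h1 := hT₁ a (le_max_left _ _)
  have h2 := hT₂ a (le_max_right _ _)
  obtain ⟨x, hx, hxa⟩ := exists_isFlow hA h1.1 (fun j => if j ∈ V then (1:ℝ) else 0)
  have hxa' : ∀ j, x a j = if j ∈ V then (1:ℝ) else 0 := fun j => by rw [hxa]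
  have hx0 : ∀ t, a ≤ t → ∀ j, 0 ≤ x t j := fun t ht =>
    hx.le_of_le hA hK.nonneg h1.1 ht fun j => by rw [hxa']; split_ifs <;> norm_num
  have hx1 : ∀ t, a ≤ t → ∀ j, x t j ≤ 1 := fun t ht =>
    hx.ge_of_ge hA hK.nonneg h1.1 ht fun j => by rw [hxa']; split_ifs <;> norm_num
  have hhigh : ∀ t, a ≤ t → 3 / 4 ≤ x t v := by
    intro t ht
    have h := hx.sub_integral_cut_le hA hK.nonneg V h1.1 ht (m := 1)
      (fun s hs j _ k _ => by linarith [hx0 s hs.1 k, hx1 s hs.1 j])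
      (fun j hj => by simp [hxa', hj]) hvV
    linarith [h1.2 t ht]
  have hlow : ∀ t, a ≤ t → x t u ≤ 1 / 4 := by
    intro t ht
    have h := (hx.affine 1 (-1)).sub_integral_cut_le hA hK.nonneg Vᶜ h1.1 ht (m := 1)
      (fun s hs j _ k _ => by linarith [hx0 s hs.1 j, hx1 s hs.1 k])
      (fun j hj => by simp [hxa', Finset.mem_compl.1 hj]) (Finset.mem_compl.2 huV)
    rw [compl_compl] at h
    linarith [h2.2 t ht]
  obtain ⟨c, hc⟩ := hcons x hx
  have hc1 : 3 / 4 ≤ c := ge_of_tendsto (hc v) (eventually_atTop.2 ⟨a, hhigh⟩)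
  have hc2 : c ≤ 1 / 4 := le_of_tendsto (hc u) (eventually_atTop.2 ⟨a, hlow⟩)
  linarith

/-- for nonnegative cut-balanced weights, the protocol establishes consensus
(every solution converges to a common value, nonzero for some solution) iff the graph of
essential interactions is strongly connected. -/
theorem stmt18 {N : ℕ} (hN : 2 ≤ N) (A : ℝ → Matrix (Fin N) (Fin N) ℝ)
    (hA : IsAdjacency A) (hCB : CutBalanced A)
    (hpos : ∀ᵐ t ∂(volume.restrict (Set.Ici (0:ℝ))), ∀ j k, 0 ≤ A t j k) :
    ((∀ x : ℝ → Fin N → ℝ, IsSolution A x →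
        ∃ c : ℝ, ∀ i, Tendsto (fun t => x t i) atTop (𝓝 c)) ∧
      (∃ x : ℝ → Fin N → ℝ, IsSolution A x ∧
        ∃ c : ℝ, c ≠ 0 ∧ ∀ i, Tendsto (fun t => x t i) atTop (𝓝 c)))
    ↔ (∀ u v : Fin N, EssReach A u v) := by
  obtain ⟨K, hK1, hK⟩ := hCB.exists_nonnegCutBound hpos
  simp only [isSolution_iff_isFlow hA hpos]
  constructor
  · rintro ⟨h, -⟩
    exact essReach_of_consensus hA hK h
  · intro hconn
    obtain ⟨n, rfl⟩ : ∃ n, N = n + 1 := ⟨N - 1, by omega⟩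
    exact ⟨fun x hx => hx.exists_tendsto_of_essReach hA hK1 hK hconn,
      fun _ _ => 1, isFlow_const A 1, 1, one_ne_zero, fun _ => tendsto_const_nhds⟩
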